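/- Let p = q = 1/2 (symmetric simple random walk). Then the cross-moment of the maximum and the absolute minimum satisfies E(M_n^+ · M_n^-)/n → 2 ln 2 - 1 as n → ∞. -/

import Mathlib

open Finset Filter

/-- The value `±1` of a single step of the walk, driven by a Boolean. -/
def step (b : Bool) : ℤ := if b then 1 else -1

/-- The partial sum `S_j = X_1 + ⋯ + X_j` of the simple random walk driven by `ω`. -/
def walk {n : ℕ} (ω : Fin n → Bool) (j : ℕ) : ℤ :=
  ∑ i ∈ Finset.univ.filter fun i : Fin n => (i : ℕ) < j, step (ω i)

/-- `M_n^+ = max_{0 ≤ j ≤ n} S_j`. -/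
def mplus {n : ℕ} (ω : Fin n → Bool) : ℤ :=
  (Finset.range (n + 1)).sup' (by simp) (walk ω)

/-- `M_n^- = -min_{0 ≤ j ≤ n} S_j`. -/
def mminus {n : ℕ} (ω : Fin n → Bool) : ℤ :=
  -((Finset.range (n + 1)).inf' (by simp) (walk ω))

/-- The probability weight of the path `ω` when `P{Xᵢ = 1} = p`, `P{Xᵢ = -1} = 1 - p`,
independently over `i`. -/
def wt (p : ℝ) {n : ℕ} (ω : Fin n → Bool) : ℝ :=
  ∏ i, if ω i then p else 1 - p

/-- The probability of an event `A` for a walk of length `n`. -/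
noncomputable def prob (p : ℝ) {n : ℕ} (A : Set (Fin n → Bool)) : ℝ :=
  ∑ ω : Fin n → Bool, A.indicator (wt p) ω

/-- The expectation of a functional `f` of a walk of length `n`. -/
noncomputable def expectation (p : ℝ) {n : ℕ} (f : (Fin n → Bool) → ℝ) : ℝ :=
  ∑ ω : Fin n → Bool, wt p ω * f ω


lemma walk_zero {n : ℕ} (ω : Fin n → Bool) : walk ω 0 = 0 := by
  simp [walk]

lemma walk_cons_succ {n : ℕ} (b : Bool) (ω : Fin n → Bool) (j : ℕ) :
    walk (Fin.cons b ω : Fin (n + 1) → Bool) (j + 1) = step b + walk ω j := by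
  simp [walk, Finset.sum_filter, Fin.sum_univ_succ]

lemma le_mplus_iff {n : ℕ} (ω : Fin n → Bool) (a : ℤ) :
    a ≤ mplus ω ↔ ∃ j ≤ n, a ≤ walk ω j := by
  simp [mplus, Finset.le_sup'_iff]

lemma le_mminus_iff {n : ℕ} (ω : Fin n → Bool) (a : ℤ) :
    a ≤ mminus ω ↔ ∃ j ≤ n, walk ω j ≤ -a := by
  rw [mminus, le_neg]
  simp [Finset.inf'_le_iff]

lemma exists_le_succ_iff {n : ℕ} {P : ℕ → Prop} :
    (∃ j ≤ n + 1, P j) ↔ P 0 ∨ ∃ j ≤ n, P (j + 1) := by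
  constructor
  · rintro ⟨_ | j, hj, h⟩
    · exact Or.inl h
    · exact Or.inr ⟨j, by omega, h⟩
  · rintro (h | ⟨j, hj, h⟩)
    · exact ⟨0, by omega, h⟩
    · exact ⟨j + 1, by omega, h⟩

lemma mplus_cons {n : ℕ} (b : Bool) (ω : Fin n → Bool) :
    mplus (Fin.cons b ω : Fin (n + 1) → Bool) = max 0 (step b + mplus ω) := by
  refine eq_of_forall_le_iff fun a => ?_
  rw [le_mplus_iff, exists_le_succ_iff, le_max_iff, walk_zero, ← sub_le_iff_le_add', le_mplus_iff]
  simp only [walk_cons_succ, sub_le_iff_le_add']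

lemma mminus_cons {n : ℕ} (b : Bool) (ω : Fin n → Bool) :
    mminus (Fin.cons b ω : Fin (n + 1) → Bool) = max 0 (mminus ω - step b) := by
  refine eq_of_forall_le_iff fun a => ?_
  rw [le_mminus_iff, exists_le_succ_iff, le_max_iff, walk_zero, le_sub_iff_add_le, le_mminus_iff]
  simp only [walk_cons_succ]
  refine or_congr (by omega) (exists_congr fun j => and_congr_right fun _ => by omega)

lemma mplus_nonneg {n : ℕ} (ω : Fin n → Bool) : 0 ≤ mplus ω :=
  (le_mplus_iff ω 0).2 ⟨0, by omega, (walk_zero ω).ge⟩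

lemma mminus_nonneg {n : ℕ} (ω : Fin n → Bool) : 0 ≤ mminus ω :=
  (le_mminus_iff ω 0).2 ⟨0, by omega, by simp [walk_zero]⟩

lemma mplus_of_fin_zero (ω : Fin 0 → Bool) : mplus ω = 0 := by
  simp [mplus, walk]

lemma mminus_of_fin_zero (ω : Fin 0 → Bool) : mminus ω = 0 := by
  simp [mminus, walk]

lemma mplus_le {n : ℕ} (ω : Fin n → Bool) : mplus ω ≤ n := by
  induction n with
  | zero => simp [mplus_of_fin_zero]
  | succ n ih =>
    rw [← Fin.cons_self_tail ω, mplus_cons]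
    have := ih (Fin.tail ω)
    have : step (ω 0) ≤ 1 := by unfold step; split <;> norm_num
    push_cast
    omega

lemma mminus_le {n : ℕ} (ω : Fin n → Bool) : mminus ω ≤ n := by
  induction n with
  | zero => simp [mminus_of_fin_zero]
  | succ n ih =>
    rw [← Fin.cons_self_tail ω, mminus_cons]
    have := ih (Fin.tail ω)
    have : -1 ≤ step (ω 0) := by unfold step; split <;> norm_num
    push_cast
    omega

lemma expectation_fin_zero (p : ℝ) (f : (Fin 0 → Bool) → ℝ) :
    expectation p f = f ![] := by
  simp [expectation, wt, Matrix.empty_eq]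

lemma expectation_succ (p : ℝ) {n : ℕ} (f : (Fin (n + 1) → Bool) → ℝ) :
    expectation p f = p * expectation p (fun ω : Fin n → Bool => f (Fin.cons true ω)) +
      (1 - p) * expectation p (fun ω : Fin n → Bool => f (Fin.cons false ω)) := by
  unfold expectation
  rw [← (Fin.consEquiv fun _ : Fin (n + 1) => Bool).sum_comp, Fintype.sum_prod_type]
  simp [wt, Fin.prod_univ_succ, Finset.mul_sum, mul_assoc]
  rfl

lemma expectation_add (p : ℝ) {n : ℕ} (f g : (Fin n → Bool) → ℝ) :
    expectation p (fun ω => f ω + g ω) = expectation p f + expectation p g := by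
  simp [expectation, mul_add, Finset.sum_add_distrib]

lemma expectation_const_mul (p c : ℝ) {n : ℕ} (f : (Fin n → Bool) → ℝ) :
    expectation p (fun ω => c * f ω) = c * expectation p f := by
  simp only [expectation, Finset.mul_sum]
  exact Finset.sum_congr rfl fun _ _ => by ring

lemma expectation_sum (p : ℝ) {n : ℕ} {ι : Type*} (s : Finset ι) (f : ι → (Fin n → Bool) → ℝ) :
    expectation p (fun ω => ∑ i ∈ s, f i ω) = ∑ i ∈ s, expectation p (f i) := by
  simp only [expectation, Finset.mul_sum]
  exact Finset.sum_comm

lemma expectation_const (p c : ℝ) (n : ℕ) :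
    expectation p (fun _ : Fin n → Bool => c) = c := by
  induction n with
  | zero => rw [expectation_fin_zero]
  | succ n ih => rw [expectation_succ, ih]; ring

lemma expectation_mono {p : ℝ} (hp : 0 ≤ p) (hp' : p ≤ 1) {n : ℕ} {f g : (Fin n → Bool) → ℝ}
    (h : ∀ ω, f ω ≤ g ω) : expectation p f ≤ expectation p g := by
  refine Finset.sum_le_sum fun ω _ => mul_le_mul_of_nonneg_left (h ω) ?_
  refine Finset.prod_nonneg fun i _ => ?_
  split <;> linarith

/-- `E (M_n^+ (M_n^+ + 1)) = n` for the symmetric walk. -/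
lemma expectation_mplus_mul_succ (n : ℕ) :
    expectation (1/2) (fun ω : Fin n → Bool => (mplus ω : ℝ) ^ 2 + mplus ω) = n := by
  induction n with
  | zero => simp [expectation_fin_zero, mplus_of_fin_zero]
  | succ n ih =>
    have key : ∀ ω : Fin n → Bool,
        ((mplus (Fin.cons true ω : Fin (n + 1) → Bool) : ℝ) ^ 2 +
            mplus (Fin.cons true ω : Fin (n + 1) → Bool)) +
          ((mplus (Fin.cons false ω : Fin (n + 1) → Bool) : ℝ) ^ 2 +
            mplus (Fin.cons false ω : Fin (n + 1) → Bool)) =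
        2 * ((mplus ω : ℝ) ^ 2 + mplus ω) + 2 := by
      intro ω
      have h0 := mplus_nonneg ω
      rw [mplus_cons, mplus_cons]
      simp only [step, if_true, Bool.false_eq_true, if_false]
      rw [max_eq_right (by omega : 0 ≤ 1 + mplus ω)]
      rcases h0.eq_or_lt with h | h
      · rw [← h]; norm_num
      · rw [max_eq_right (by omega : 0 ≤ -1 + mplus ω)]
        push_cast
        ring
    have h2 := expectation_add (1/2) (fun ω : Fin n → Bool =>
        (mplus (Fin.cons true ω : Fin (n + 1) → Bool) : ℝ) ^ 2 +
            mplus (Fin.cons true ω : Fin (n + 1) → Bool)) (fun ω =>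
          (mplus (Fin.cons false ω : Fin (n + 1) → Bool) : ℝ) ^ 2 +
            mplus (Fin.cons false ω : Fin (n + 1) → Bool))
    simp only [key] at h2
    rw [expectation_add, expectation_const_mul, ih, expectation_const] at h2
    rw [expectation_succ]
    push_cast
    linarith

/-- The probability that the maximum of a symmetric walk of length `n` is at least `m`. -/
noncomputable def maxTail (n : ℕ) (m : ℤ) : ℝ :=
  expectation (1/2) (fun ω : Fin n → Bool => if m ≤ mplus ω then 1 else 0)

lemma maxTail_of_lt {n : ℕ} {m : ℤ} (h : n < m) : maxTail n m = 0 := by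
  have : ∀ ω : Fin n → Bool, ¬ m ≤ mplus ω := fun ω => by have := mplus_le ω; omega
  simp only [maxTail, this, if_false, expectation_const]

lemma maxTail_of_nonpos {n : ℕ} {m : ℤ} (h : m ≤ 0) : maxTail n m = 1 := by
  have : ∀ ω : Fin n → Bool, m ≤ mplus ω := fun ω => h.trans (mplus_nonneg ω)
  simp only [maxTail, this, if_true, expectation_const]

lemma maxTail_succ {n : ℕ} {m : ℤ} (h : 0 < m) :
    maxTail (n + 1) m = (maxTail n (m - 1) + maxTail n (m + 1)) / 2 := by
  have h1 : ∀ x : ℤ, m ≤ max 0 (1 + x) ↔ m - 1 ≤ x := by omega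
  have h2 : ∀ x : ℤ, m ≤ max 0 (-1 + x) ↔ m + 1 ≤ x := by omega
  simp only [maxTail, expectation_succ, mplus_cons, step, if_true, Bool.false_eq_true, if_false,
    h1, h2]
  ring

lemma expectation_le_mminus (n : ℕ) (m : ℤ) :
    expectation (1/2) (fun ω : Fin n → Bool => if m ≤ mminus ω then 1 else 0) = maxTail n m := by
  induction n generalizing m with
  | zero => simp [maxTail, mplus_of_fin_zero, mminus_of_fin_zero]
  | succ n ih =>
    rcases le_or_gt m 0 with h | h
    · have : ∀ ω : Fin (n + 1) → Bool, m ≤ mminus ω := fun ω => h.trans (mminus_nonneg ω)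
      simp only [this, if_true, expectation_const, maxTail_of_nonpos h]
    · have h1 : ∀ x : ℤ, m ≤ max 0 (x - 1) ↔ m + 1 ≤ x := by omega
      have h2 : ∀ x : ℤ, m ≤ max 0 (x - -1) ↔ m - 1 ≤ x := by omega
      rw [maxTail_succ h, ← ih, ← ih]
      simp only [expectation_succ, mminus_cons, step, if_true, Bool.false_eq_true, if_false,
        h1, h2]
      ring

lemma sum_range_alternating_add (f : ℕ → ℝ) (K : ℕ) :
    ∑ k ∈ Finset.range K, (-1) ^ k * (f k + f (k + 1)) = f 0 - (-1) ^ K * f K := by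
  induction K with
  | zero => simp
  | succ K ih => rw [Finset.sum_range_succ, ih]; ring

lemma maxTail_eq_alternating_sum {K n : ℕ} (hK : n ≤ K) {c : ℤ} (hc : 0 < c) :
    maxTail n c = ∑ k ∈ Finset.range K, (-1) ^ k *
      (maxTail n ((k + 1) * c) + maxTail n (c + (k + 1) * c)) := by
  have key := sum_range_alternating_add (fun k : ℕ => maxTail n ((k + 1) * c)) K
  rw [maxTail_of_lt (m := (K + 1) * c) (by nlinarith)] at key
  simp only [CharP.cast_eq_zero, zero_add, one_mul, mul_zero, sub_zero] at key
  rw [← key]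
  refine Finset.sum_congr rfl fun k _ => ?_
  rw [show c + ((k : ℤ) + 1) * c = (((k + 1 : ℕ) : ℤ) + 1) * c by push_cast; ring]

lemma expectation_joint_tail_zero_left {K n : ℕ} (hK : n ≤ K) {b : ℤ} (hb : 0 < b) :
    expectation (1/2) (fun ω : Fin n → Bool => if 0 ≤ mplus ω ∧ b ≤ mminus ω then 1 else 0) =
      ∑ k ∈ Finset.range K, (-1) ^ k *
        (maxTail n (0 + (k + 1) * (0 + b)) + maxTail n (b + (k + 1) * (0 + b))) := by
  have h : ∀ ω : Fin n → Bool, 0 ≤ mplus ω := mplus_nonneg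
  simp only [h, true_and, expectation_le_mminus, zero_add]
  exact maxTail_eq_alternating_sum hK hb

lemma expectation_joint_tail_zero_right {K n : ℕ} (hK : n ≤ K) {a : ℤ} (ha : 0 < a) :
    expectation (1/2) (fun ω : Fin n → Bool => if a ≤ mplus ω ∧ 0 ≤ mminus ω then 1 else 0) =
      ∑ k ∈ Finset.range K, (-1) ^ k *
        (maxTail n (a + (k + 1) * (a + 0)) + maxTail n (0 + (k + 1) * (a + 0))) := by
  have h : ∀ ω : Fin n → Bool, 0 ≤ mminus ω := mminus_nonneg
  simp only [h, and_true, zero_add, add_zero]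
  rw [← maxTail, maxTail_eq_alternating_sum hK ha]
  simp only [add_comm]

/-- The joint tail of the maximum and of the absolute minimum, by iterated reflection. -/
lemma expectation_joint_tail {K n : ℕ} (hK : n ≤ K) {a b : ℤ} (ha : 0 ≤ a) (hb : 0 ≤ b)
    (hab : 0 < a + b) :
    expectation (1/2) (fun ω : Fin n → Bool => if a ≤ mplus ω ∧ b ≤ mminus ω then 1 else 0) =
      ∑ k ∈ Finset.range K, (-1) ^ k *
        (maxTail n (a + (k + 1) * (a + b)) + maxTail n (b + (k + 1) * (a + b))) := by
  induction n generalizing a b with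
  | zero =>
    rcases ha.eq_or_lt with rfl | ha
    · exact expectation_joint_tail_zero_left hK (by omega)
    rcases hb.eq_or_lt with rfl | hb
    · exact expectation_joint_tail_zero_right hK (by omega)
    have h1 : ∀ k : ℕ, maxTail 0 (a + (k + 1) * (a + b)) = 0 := fun k =>
      maxTail_of_lt (by push_cast; positivity)
    have h2 : ∀ k : ℕ, maxTail 0 (b + (k + 1) * (a + b)) = 0 := fun k =>
      maxTail_of_lt (by push_cast; positivity)
    simp [h1, h2, expectation_fin_zero, mplus_of_fin_zero, ha.not_ge]
  | succ n ih =>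
    rcases ha.eq_or_lt with rfl | ha
    · exact expectation_joint_tail_zero_left hK (by omega)
    rcases hb.eq_or_lt with rfl | hb
    · exact expectation_joint_tail_zero_right hK (by omega)
    have p1 : ∀ x : ℤ, a ≤ max 0 (1 + x) ↔ a - 1 ≤ x := by omega
    have p2 : ∀ x : ℤ, a ≤ max 0 (-1 + x) ↔ a + 1 ≤ x := by omega
    have m1 : ∀ x : ℤ, b ≤ max 0 (x - 1) ↔ b + 1 ≤ x := by omega
    have m2 : ∀ x : ℤ, b ≤ max 0 (x - -1) ↔ b - 1 ≤ x := by omega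
    rw [expectation_succ]
    simp only [mplus_cons, mminus_cons, step, if_true, Bool.false_eq_true, if_false,
      p1, p2, m1, m2]
    rw [ih (by omega) (by omega) (by omega) (by omega),
      ih (by omega) (by omega) (by omega) (by omega), Finset.mul_sum, Finset.mul_sum,
      ← Finset.sum_add_distrib]
    refine Finset.sum_congr rfl fun k _ => ?_
    rw [maxTail_succ (by positivity : 0 < a + (k + 1) * (a + b)),
      maxTail_succ (by positivity : 0 < b + (k + 1) * (a + b)),
      show a - 1 + (b + 1) = a + b by ring, show a + 1 + (b - 1) = a + b by ring]
    simp only [sub_add_eq_add_sub, add_right_comm _ (1 : ℤ) _]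
    ring_nf

lemma sum_range_alternating_harmonic (n : ℕ) :
    ∑ k ∈ Finset.range (2 * n), (-1) ^ k * (1 / ((k : ℝ) + 1)) =
      (harmonic (2 * n) : ℝ) - harmonic n := by
  induction n with
  | zero => simp
  | succ n ih =>
    rw [show 2 * (n + 1) = 2 * n + 1 + 1 by ring, Finset.sum_range_succ, Finset.sum_range_succ, ih,
      harmonic_succ, harmonic_succ, harmonic_succ]
    have h : (-1 : ℝ) ^ (2 * n) = 1 := by rw [pow_mul]; norm_num
    rw [pow_succ, h]
    push_cast
    field_simp
    ring

lemma tendsto_harmonic_two_mul_sub :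
    Tendsto (fun n : ℕ => (harmonic (2 * n) : ℝ) - harmonic n) atTop (nhds (Real.log 2)) := by
  have h := Real.tendsto_harmonic_sub_log
  have h2 := h.comp (tendsto_id.const_mul_atTop' (Nat.succ_pos 1))
  have h3 := (h2.sub h).add_const (Real.log 2)
  rw [sub_self, zero_add] at h3
  refine h3.congr' ?_
  filter_upwards [eventually_gt_atTop 0] with n hn
  have hn' : (n : ℝ) ≠ 0 := by positivity
  simp only [Function.comp, id]
  push_cast
  rw [Real.log_mul (by norm_num) hn']
  ring

lemma summable_one_div_mul_succ :
    Summable fun k : ℕ => 1 / (((k : ℝ) + 1) * (k + 2)) := by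
  have h := (summable_nat_add_iff 1).2 (Real.summable_one_div_nat_pow.2 one_lt_two)
  refine h.of_nonneg_of_le (fun k => by positivity) fun k => ?_
  push_cast
  gcongr
  nlinarith

lemma hasSum_alternating_one_div_mul_succ :
    HasSum (fun k : ℕ => (-1) ^ k * (1 / (((k : ℝ) + 1) * (k + 2)))) (2 * Real.log 2 - 1) := by
  have hs : Summable fun k : ℕ => (-1) ^ k * (1 / (((k : ℝ) + 1) * (k + 2))) := by
    refine summable_one_div_mul_succ.of_norm_bounded fun k => le_of_eq ?_
    rw [norm_mul, norm_pow, norm_neg, norm_one, one_pow, one_mul,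
      Real.norm_of_nonneg (by positivity)]
  convert hs.hasSum
  have hsub : Tendsto (fun n : ℕ => 2 * n) atTop atTop :=
    tendsto_id.const_mul_atTop' (Nat.succ_pos 1)
  refine tendsto_nhds_unique ?_ (hs.hasSum.tendsto_sum_nat.comp hsub)
  have h0 : Tendsto (fun n : ℕ => 1 / (((2 * n : ℕ) : ℝ) + 1)) atTop (nhds 0) :=
    tendsto_one_div_add_atTop_nhds_zero_nat.comp hsub
  have := (tendsto_harmonic_two_mul_sub.const_mul 2).sub (h0.const_sub 1)
  rw [sub_zero] at this
  refine this.congr fun n => ?_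
  have key := sum_range_alternating_add (fun k : ℕ => 1 / ((k : ℝ) + 1)) (2 * n)
  rw [pow_mul] at key
  norm_num at key
  rw [← sum_range_alternating_harmonic]
  simp only [Function.comp]
  norm_num
  rw [← key, Finset.mul_sum, ← Finset.sum_sub_distrib]
  refine Finset.sum_congr rfl fun k _ => ?_
  field_simp
  ring

/-- The number of pairs of positive integers `(a, b)` with `(d + 1) * a + d * b ≤ m`. -/
def triangleCount (d m : ℕ) : ℕ :=
  ∑ a ∈ Finset.Icc 1 (m / (d + 1)), (m - (d + 1) * a) / d

lemma mul_le_of_mem_Icc_div {d m a : ℕ} (ha : a ∈ Finset.Icc 1 (m / (d + 1))) :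
    (d + 1) * a ≤ m := by
  rw [mul_comm]
  exact (Nat.le_div_iff_mul_le (Nat.succ_pos d)).1 (Finset.mem_Icc.1 ha).2

lemma sum_ite_eq_triangleCount {d m n : ℕ} (hd : 0 < d) (hm : m ≤ n) :
    ∑ a ∈ Finset.Icc 1 n, ∑ b ∈ Finset.Icc 1 n, (if (d + 1) * a + d * b ≤ m then 1 else 0) =
      triangleCount d m := by
  have hsub : Finset.Icc 1 (m / (d + 1)) ⊆ Finset.Icc 1 n :=
    Finset.Icc_subset_Icc_right ((Nat.div_le_self _ _).trans hm)
  rw [triangleCount, ← Finset.sum_subset hsub]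
  · refine Finset.sum_congr rfl fun a ha => ?_
    have ha := mul_le_of_mem_Icc_div ha
    rw [Finset.sum_boole, Nat.cast_id]
    have : (Finset.Icc 1 n).filter (fun b => (d + 1) * a + d * b ≤ m) =
        Finset.Icc 1 ((m - (d + 1) * a) / d) := by
      ext b
      rw [Finset.mem_filter, Finset.mem_Icc, Finset.mem_Icc, Nat.le_div_iff_mul_le hd, mul_comm b]
      have : b ≤ d * b := Nat.le_mul_of_pos_left b hd
      omega
    rw [this, Nat.card_Icc, Nat.add_sub_cancel]
  · intro a ha ha'
    rw [Finset.mem_Icc] at ha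
    rw [Finset.mem_Icc, Nat.le_div_iff_mul_le (by omega), mul_comm] at ha'
    exact Finset.sum_eq_zero fun b _ => if_neg (by omega)

lemma triangle_sum (d m : ℝ) (A : ℕ) :
    ∑ a ∈ Finset.Icc 1 A, (m - (d + 1) * a) = m * A - (d + 1) * (A * (A + 1)) / 2 := by
  induction A with
  | zero => simp
  | succ A ih =>
    rw [Finset.sum_Icc_succ_top (by omega), ih]
    push_cast
    ring

lemma triangleCount_term_bounds {d m a : ℕ} (hd : 0 < d) (ha : (d + 1) * a ≤ m) :
    ((m : ℝ) - (d + 1) * a) / d - 1 ≤ ((m - (d + 1) * a) / d : ℕ) ∧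
      (((m - (d + 1) * a) / d : ℕ) : ℝ) ≤ ((m : ℝ) - (d + 1) * a) / d := by
  have hd' : (0 : ℝ) < d := by positivity
  have hc : (((m - (d + 1) * a : ℕ)) : ℝ) = (m : ℝ) - (d + 1) * a := by
    rw [Nat.cast_sub ha]; push_cast; ring
  rw [← hc]
  refine ⟨?_, Nat.cast_div_le⟩
  rw [sub_le_iff_le_add, div_le_iff₀ hd']
  have := Nat.lt_mul_div_succ (m - (d + 1) * a) hd
  rw [mul_comm d] at this
  exact_mod_cast this.le

lemma triangleCount_le {d : ℕ} (hd : 0 < d) (m : ℕ) :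
    (triangleCount d m : ℝ) ≤ (m : ℝ) ^ 2 / (2 * d * (d + 1)) := by
  have hd' : (0 : ℝ) < d := by positivity
  set A := m / (d + 1)
  have h1 : (triangleCount d m : ℝ) ≤ ∑ a ∈ Finset.Icc 1 A, ((m : ℝ) - (d + 1) * a) / d := by
    rw [triangleCount]
    push_cast
    refine Finset.sum_le_sum fun a ha => ?_
    exact_mod_cast (triangleCount_term_bounds hd (mul_le_of_mem_Icc_div ha)).2
  refine h1.trans ?_
  rw [← Finset.sum_div, triangle_sum, div_le_div_iff₀ hd' (by positivity)]
  have hA0 : (0 : ℝ) ≤ A := by positivity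
  nlinarith [mul_nonneg hd'.le (sq_nonneg ((m : ℝ) - (d + 1) * A)),
    mul_nonneg hd'.le (mul_nonneg (sq_nonneg ((d : ℝ) + 1)) hA0)]

lemma le_triangleCount {d : ℕ} (hd : 0 < d) (m : ℕ) :
    (m : ℝ) ^ 2 / (2 * d * (d + 1)) - 2 * m - 1 ≤ triangleCount d m := by
  have hd' : (1 : ℝ) ≤ d := by exact_mod_cast hd
  set A := m / (d + 1)
  have h1 : ∑ a ∈ Finset.Icc 1 A, (((m : ℝ) - (d + 1) * a) / d - 1) ≤ triangleCount d m := by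
    rw [triangleCount]
    push_cast
    refine Finset.sum_le_sum fun a ha => ?_
    exact_mod_cast (triangleCount_term_bounds hd (mul_le_of_mem_Icc_div ha)).1
  refine le_trans ?_ h1
  rw [Finset.sum_sub_distrib, ← Finset.sum_div, triangle_sum, Finset.sum_const, Nat.card_Icc,
    Nat.add_sub_cancel, nsmul_one]
  have hA0 : (0 : ℝ) ≤ A := by positivity
  have hAm : (A : ℝ) ≤ m := by exact_mod_cast Nat.div_le_self _ _
  have hr0 : ((d : ℝ) + 1) * A ≤ m := by exact_mod_cast Nat.mul_div_le _ _
  have hr1 : (m : ℝ) - (d + 1) * A ≤ d + 1 := by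
    have := (Nat.lt_mul_div_succ m (Nat.succ_pos d)).le
    have : (m : ℝ) ≤ (d + 1) * (A + 1) := by exact_mod_cast this
    linarith
  have e : (m * A - (d + 1) * (A * (A + 1)) / 2) / d = (m : ℝ) ^ 2 / (2 * d * (d + 1)) -
      (m - (d + 1) * A) ^ 2 / (2 * d * (d + 1)) - A * ((d + 1) / (2 * d)) := by
    field_simp
    ring
  have h2 : ((d : ℝ) + 1) / (2 * d) ≤ 1 := by
    rw [div_le_one (by positivity)]
    linarith
  have h3 : ((m : ℝ) - (d + 1) * A) ^ 2 / (2 * d * (d + 1)) ≤ 1 := by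
    rw [div_le_one (by positivity)]
    nlinarith
  have h4 : (A : ℝ) * ((d + 1) / (2 * d)) ≤ A := mul_le_of_le_one_right hA0 h2
  rw [e]
  linarith

lemma sum_maxTail_eq_expectation_triangleCount {d n : ℕ} (hd : 0 < d) :
    ∑ a ∈ Finset.Icc 1 n, ∑ b ∈ Finset.Icc 1 n, maxTail n (((d + 1) * a + d * b : ℕ) : ℤ) =
      expectation (1/2) (fun ω : Fin n → Bool => (triangleCount d (mplus ω).toNat : ℝ)) := by
  simp only [maxTail, ← expectation_sum]
  congr 1
  ext ω
  have h0 := mplus_nonneg ω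
  have h1 := mplus_le ω
  rw [← sum_ite_eq_triangleCount hd (n := n) (by omega)]
  push_cast
  refine Finset.sum_congr rfl fun a _ => Finset.sum_congr rfl fun b _ => if_congr ?_ rfl rfl
  rw [Int.le_toNat h0]
  push_cast
  rfl

lemma eq_sum_ite_le {n : ℕ} {x : ℤ} (h0 : 0 ≤ x) (h1 : x ≤ n) :
    (x : ℝ) = ∑ a ∈ Finset.Icc 1 n, if (a : ℤ) ≤ x then (1 : ℝ) else 0 := by
  lift x to ℕ using h0
  rw [Finset.sum_boole]
  have : (Finset.Icc 1 n).filter (fun a : ℕ => (a : ℤ) ≤ x) = Finset.Icc 1 x := by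
    ext a
    simp only [Finset.mem_filter, Finset.mem_Icc]
    omega
  rw [this, Nat.card_Icc]
  simp

lemma expectation_mplus_mul_mminus (n : ℕ) :
    expectation (1/2) (fun ω : Fin n → Bool => (mplus ω : ℝ) * (mminus ω : ℝ)) =
      ∑ k ∈ Finset.range n, (-1) ^ k * (2 * expectation (1/2)
        (fun ω : Fin n → Bool => (triangleCount (k + 1) (mplus ω).toNat : ℝ))) := by
  have h1 : ∀ ω : Fin n → Bool, (mplus ω : ℝ) * (mminus ω : ℝ) =
      ∑ a ∈ Finset.Icc 1 n, ∑ b ∈ Finset.Icc 1 n,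
        if (a : ℤ) ≤ mplus ω ∧ (b : ℤ) ≤ mminus ω then (1 : ℝ) else 0 := by
    intro ω
    rw [eq_sum_ite_le (mplus_nonneg ω) (mplus_le ω),
      eq_sum_ite_le (mminus_nonneg ω) (mminus_le ω), Finset.sum_mul_sum]
    simp only [ite_and, mul_ite, mul_one, mul_zero]
    refine Finset.sum_congr rfl fun a _ => Finset.sum_congr rfl fun b _ => ?_
    split_ifs <;> rfl
  have h2 : ∀ a ∈ Finset.Icc 1 n, ∀ b ∈ Finset.Icc 1 n, expectation (1/2)
      (fun ω : Fin n → Bool => if (a : ℤ) ≤ mplus ω ∧ (b : ℤ) ≤ mminus ω then (1 : ℝ) else 0) =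
      ∑ k ∈ Finset.range n, ((-1) ^ k * maxTail n (((k + 1 + 1) * a + (k + 1) * b : ℕ) : ℤ) +
        (-1) ^ k * maxTail n (((k + 1 + 1) * b + (k + 1) * a : ℕ) : ℤ)) := by
    intro a ha b hb
    rw [Finset.mem_Icc] at ha hb
    rw [expectation_joint_tail le_rfl (by omega) (by omega) (by omega)]
    refine Finset.sum_congr rfl fun k _ => ?_
    rw [← mul_add]
    push_cast
    ring_nf
  simp only [h1, expectation_sum]
  rw [Finset.sum_congr rfl fun a ha => Finset.sum_congr rfl fun b hb => h2 a ha b hb]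
  rw [Finset.sum_congr rfl fun a _ => Finset.sum_comm, Finset.sum_comm]
  refine Finset.sum_congr rfl fun k _ => ?_
  rw [← sum_maxTail_eq_expectation_triangleCount (Nat.succ_pos k)]
  simp only [Finset.sum_add_distrib, ← Finset.mul_sum]
  rw [Finset.sum_comm (f := fun a b : ℕ => maxTail n (((k + 1 + 1) * b + (k + 1) * a : ℕ) : ℤ))]
  ring

lemma expectation_mplus_nonneg (n : ℕ) :
    0 ≤ expectation (1/2) (fun ω : Fin n → Bool => (mplus ω : ℝ)) := by
  rw [← expectation_const (1/2) 0 n]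
  exact expectation_mono (by norm_num) (by norm_num) fun ω => by exact_mod_cast mplus_nonneg ω

lemma expectation_mplus_sq (n : ℕ) :
    expectation (1/2) (fun ω : Fin n → Bool => (mplus ω : ℝ) ^ 2) =
      n - expectation (1/2) (fun ω : Fin n → Bool => (mplus ω : ℝ)) := by
  rw [eq_sub_iff_add_eq, ← expectation_add, expectation_mplus_mul_succ]

lemma expectation_mplus_le (n : ℕ) :
    expectation (1/2) (fun ω : Fin n → Bool => (mplus ω : ℝ)) ≤ √n := by
  set μ := expectation (1/2) (fun ω : Fin n → Bool => (mplus ω : ℝ)) with hμ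
  have h : expectation (1/2) (fun ω : Fin n → Bool => 2 * √n * (mplus ω : ℝ)) ≤
      expectation (1/2) (fun ω : Fin n → Bool => (mplus ω : ℝ) ^ 2 + √n ^ 2) :=
    expectation_mono (by norm_num) (by norm_num) fun ω => by
      nlinarith [sq_nonneg ((mplus ω : ℝ) - √n)]
  rw [expectation_add, expectation_const_mul, expectation_const, expectation_mplus_sq, ← hμ,
    Real.sq_sqrt (by positivity)] at h
  have hs := Real.sq_sqrt (Nat.cast_nonneg (α := ℝ) n)
  have h0 := Real.sqrt_nonneg (n : ℝ)
  have hμ0 : 0 ≤ μ := expectation_mplus_nonneg n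
  by_contra! hlt
  nlinarith

lemma expectation_triangleCount_le {d : ℕ} (hd : 0 < d) (n : ℕ) :
    expectation (1/2) (fun ω : Fin n → Bool => (triangleCount d (mplus ω).toNat : ℝ)) ≤
      n / (2 * d * (d + 1)) := by
  have h : expectation (1/2) (fun ω : Fin n → Bool => (triangleCount d (mplus ω).toNat : ℝ)) ≤
      expectation (1/2)
        (fun ω : Fin n → Bool => 1 / (2 * d * (d + 1) : ℝ) * (mplus ω : ℝ) ^ 2) := by
    refine expectation_mono (by norm_num) (by norm_num) fun ω => ?_
    refine (triangleCount_le hd _).trans_eq ?_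
    rw [← Int.cast_natCast (mplus ω).toNat, Int.toNat_of_nonneg (mplus_nonneg ω)]
    ring
  rw [expectation_const_mul, expectation_mplus_sq] at h
  refine h.trans ?_
  rw [one_div_mul_eq_div]
  gcongr
  linarith [expectation_mplus_nonneg n]

lemma le_expectation_triangleCount {d : ℕ} (hd : 0 < d) (n : ℕ) :
    n / (2 * d * (d + 1)) - 3 * √n - 1 ≤
      expectation (1/2) (fun ω : Fin n → Bool => (triangleCount d (mplus ω).toNat : ℝ)) := by
  have h : expectation (1/2) (fun ω : Fin n → Bool =>
      1 / (2 * d * (d + 1) : ℝ) * (mplus ω : ℝ) ^ 2 + (-2 * (mplus ω : ℝ) + -1)) ≤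
      expectation (1/2) (fun ω : Fin n → Bool => (triangleCount d (mplus ω).toNat : ℝ)) := by
    refine expectation_mono (by norm_num) (by norm_num) fun ω => ?_
    refine le_trans (le_of_eq ?_) (le_triangleCount hd _)
    rw [← Int.cast_natCast (mplus ω).toNat, Int.toNat_of_nonneg (mplus_nonneg ω)]
    ring
  rw [expectation_add, expectation_add, expectation_const_mul, expectation_const_mul,
    expectation_const, expectation_mplus_sq] at h
  refine le_trans ?_ h
  have hd' : (1 : ℝ) ≤ d := by exact_mod_cast hd
  have h0 := expectation_mplus_nonneg n
  have h1 := expectation_mplus_le n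
  have h2 : 1 / (2 * d * (d + 1) : ℝ) ≤ 1 := by
    rw [div_le_one (by positivity)]
    nlinarith
  have h3 := mul_le_mul_of_nonneg_right h2 h0
  rw [mul_sub, one_div_mul_eq_div]
  linarith

lemma tendsto_expectation_triangleCount_div {d : ℕ} (hd : 0 < d) :
    Tendsto (fun n : ℕ => expectation (1/2)
      (fun ω : Fin n → Bool => (triangleCount d (mplus ω).toNat : ℝ)) / n) atTop
      (nhds (1 / (2 * d * (d + 1)))) := by
  have hsqrt : Tendsto (fun n : ℕ => 1 / √(n : ℝ)) atTop (nhds 0) := by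
    simp only [one_div]
    exact tendsto_inv_atTop_zero.comp (Real.tendsto_sqrt_atTop.comp tendsto_natCast_atTop_atTop)
  have hlow := ((hsqrt.const_mul 3).const_sub (1 / (2 * d * (d + 1) : ℝ))).sub
    (tendsto_one_div_atTop_nhds_zero_nat (𝕜 := ℝ))
  rw [mul_zero, sub_zero, sub_zero] at hlow
  refine tendsto_of_tendsto_of_tendsto_of_le_of_le' hlow tendsto_const_nhds ?_ ?_
  · filter_upwards [eventually_gt_atTop 0] with n hn
    have hn' : (0 : ℝ) < n := by positivity
    rw [le_div_iff₀ hn']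
    refine le_trans (le_of_eq ?_) (le_expectation_triangleCount hd n)
    have e : 1 / √(n : ℝ) * n = √n := by rw [one_div_mul_eq_div, Real.div_sqrt]
    rw [sub_mul, sub_mul, mul_assoc 3, e, one_div_mul_cancel hn'.ne']
    ring
  · filter_upwards [eventually_gt_atTop 0] with n hn
    have hn' : (0 : ℝ) < n := by positivity
    rw [div_le_iff₀ hn', one_div_mul_eq_div]
    exact expectation_triangleCount_le hd n

lemma expectation_triangleCount_eq_zero {d n : ℕ} (h : n < d) :
    expectation (1/2) (fun ω : Fin n → Bool => (triangleCount d (mplus ω).toNat : ℝ)) = 0 := by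
  have : ∀ ω : Fin n → Bool, triangleCount d (mplus ω).toNat = 0 := by
    intro ω
    have := mplus_le ω
    rw [triangleCount, Nat.div_eq_of_lt (by omega)]
    rfl
  simp only [this, Nat.cast_zero, expectation_const]

theorem statement4 :
    Tendsto
      (fun n : ℕ =>
        expectation (1/2) (fun ω : Fin n → Bool => (mplus ω : ℝ) * (mminus ω : ℝ)) / n)
      atTop (nhds (2 * Real.log 2 - 1)) := by
  rw [← hasSum_alternating_one_div_mul_succ.tsum_eq]
  have hlim := tendsto_tsum_of_dominated_convergence (𝓕 := atTop)
    (f := fun (n k : ℕ) => (-1 : ℝ) ^ k * (2 * (expectation (1/2)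
      (fun ω : Fin n → Bool => (triangleCount (k + 1) (mplus ω).toNat : ℝ)) / n)))
    (g := fun k : ℕ => (-1 : ℝ) ^ k * (1 / (((k : ℝ) + 1) * (k + 2))))
    summable_one_div_mul_succ ?_ ?_
  · refine hlim.congr fun n => ?_
    rw [expectation_mplus_mul_mminus, Finset.sum_div, tsum_eq_sum (s := Finset.range n)]
    · exact Finset.sum_congr rfl fun k _ => by ring
    · intro k hk
      rw [Finset.mem_range] at hk
      rw [expectation_triangleCount_eq_zero (by omega)]
      simp
  · intro k
    have := ((tendsto_expectation_triangleCount_div (Nat.succ_pos k)).const_mul 2).const_mul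
      ((-1 : ℝ) ^ k)
    convert this using 2
    push_cast
    field_simp
    ring
  · filter_upwards [eventually_gt_atTop 0] with n hn k
    have hn' : (0 : ℝ) < n := by positivity
    have h0 : 0 ≤ expectation (1/2)
        (fun ω : Fin n → Bool => (triangleCount (k + 1) (mplus ω).toNat : ℝ)) := by
      rw [← expectation_const (1/2) 0 n]
      exact expectation_mono (by norm_num) (by norm_num) fun ω => Nat.cast_nonneg _
    rw [norm_mul, norm_pow, norm_neg, norm_one, one_pow, one_mul,
      Real.norm_of_nonneg (by positivity), ← mul_div_assoc, div_le_iff₀ hn']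
    have := expectation_triangleCount_le (Nat.succ_pos k) n
    refine (mul_le_mul_of_nonneg_left this zero_le_two).trans_eq ?_
    push_cast
    field_simp
    ring
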